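/- Let X and Y be metric spaces and P : X → Y a submetry. Let x ∈ X and r > 0 be such that the closed ball Metric.closedBall x r is compact. Let η : ℝ → Y be continuous on Set.Icc 0 1 with η 0 = P x and with length at most r, i.e. eVariationOn η (Set.Icc 0 1) ≤ ENNReal.ofReal r. Then there exists a horizontal lift of η starting at x: a map γ : ℝ → X, continuous on Set.Icc 0 1, with γ 0 = x, with P (γ t) = η t for all t ∈ Set.Icc 0 1, and with eVariationOn γ (Set.Icc 0 1) = eVariationOn η (Set.Icc 0 1). -/

import Mathlib

/-- A map `P : X → Y` between metric spaces is a submetry if it maps every open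
ball onto the open ball of the same radius around the image of the center. -/
def IsSubmetry {X Y : Type*} [MetricSpace X] [MetricSpace Y] (P : X → Y) : Prop :=
  ∀ (x : X) (r : ℝ), 0 < r → P '' Metric.ball x r = Metric.ball (P x) r

open Set Filter Topology

theorem IsSubmetry.dist_le' {X Y : Type*} [MetricSpace X] [MetricSpace Y]
    {P : X → Y} (hP : IsSubmetry P) (a b : X) : dist (P a) (P b) ≤ dist a b := by
  by_contra! h
  have hpos : 0 < dist (P a) (P b) := dist_nonneg.trans_lt h
  have : P b ∈ Metric.ball (P a) (dist (P a) (P b)) := by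
    rw [← hP a _ hpos]
    exact ⟨b, by rwa [Metric.mem_ball, dist_comm], rfl⟩
  rw [Metric.mem_ball, dist_comm] at this
  exact lt_irrefl _ this

theorem IsSubmetry.lip {X Y : Type*} [MetricSpace X] [MetricSpace Y]
    {P : X → Y} (hP : IsSubmetry P) : LipschitzWith 1 P :=
  LipschitzWith.of_dist_le_mul fun a b => by simpa using hP.dist_le' a b

/-- exact one-step lifting -/
theorem IsSubmetry.step {X Y : Type*} [MetricSpace X] [MetricSpace Y]
    {P : X → Y} (hP : IsSubmetry P) {x : X} {r : ℝ}
    (hcompact : IsCompact (Metric.closedBall x r)) {z : X} {y : Y} {d : ℝ}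
    (hd : dist (P z) y ≤ d) (hzr : dist x z + d < r) :
    ∃ w, P w = y ∧ dist z w ≤ d := by
  have hd0 : 0 ≤ d := dist_nonneg.trans hd
  have key : ∀ ε, 0 < ε → ε ≤ r - dist x z - d →
      ∃ w ∈ Metric.closedBall x r ∩ P ⁻¹' {y}, dist z w < d + ε := by
    intro ε hε hε2
    have : y ∈ P '' Metric.ball z (d + ε) := by
      rw [hP z _ (by linarith), Metric.mem_ball, dist_comm]; linarith
    obtain ⟨w, hw, hwy⟩ := this
    rw [Metric.mem_ball, dist_comm] at hw
    refine ⟨w, ⟨?_, hwy⟩, hw⟩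
    rw [Metric.mem_closedBall, dist_comm]
    linarith [dist_triangle x z w]
  have hK : IsCompact (Metric.closedBall x r ∩ P ⁻¹' {y}) :=
    hcompact.inter_right (isClosed_singleton.preimage hP.lip.continuous)
  obtain ⟨w₀, hw₀, _⟩ := key (r - dist x z - d) (by linarith) le_rfl
  obtain ⟨w, hw, hmin⟩ := hK.exists_isMinOn ⟨w₀, hw₀⟩
    (f := fun w => dist z w) (by fun_prop)
  refine ⟨w, hw.2, ?_⟩
  by_contra! h
  obtain ⟨w', hw', hlt⟩ := key (min (dist z w - d) (r - dist x z - d))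
    (lt_min (by linarith) (by linarith)) (min_le_right _ _)
  have h1 : dist z w ≤ dist z w' := hmin hw'
  have h2 := min_le_left (dist z w - d) (r - dist x z - d)
  linarith

theorem IsSubmetry.finite_lift {X Y I : Type*} [MetricSpace X] [MetricSpace Y]
    [LinearOrder I] [OrderBot I]
    {P : X → Y} (hP : IsSubmetry P) {x : X} {r : ℝ}
    (hcompact : IsCompact (Metric.closedBall x r))
    (η : I → Y) (hη0 : η ⊥ = P x) (v : I → ℝ) (hv0 : v ⊥ = 0)
    (hv : ∀ s t, s ≤ t → dist (η s) (η t) ≤ v t - v s) (F : Finset I) :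
    ∃ γ : I → X, γ ⊥ = x ∧
      (∀ s ∈ insert ⊥ F, ∀ t ∈ insert ⊥ F, s ≤ t → dist (γ s) (γ t) ≤ v t - v s) ∧
      (∀ s ∈ insert ⊥ F, v s < r → P (γ s) = η s) := by
  have hmono : Monotone v := fun s t h => by
    have := dist_nonneg.trans (hv s t h); linarith
  induction F using Finset.induction_on_max with
  | empty =>
    refine ⟨fun _ => x, rfl, ?_, ?_⟩
    · intro s hs t ht hst
      have := hmono hst
      simp; linarith
    · intro s hs _
      simp at hs
      simp [hs, hη0]
  | insert a F ha ih =>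
    obtain ⟨γ, h0, h1, h2⟩ := ih
    by_cases hab : a = ⊥
    · subst hab
      exact ⟨γ, h0, by simpa using h1, by simpa using h2⟩
    obtain ⟨m, hm, hmax⟩ := (insert ⊥ F).exists_max_image id ⟨⊥, Finset.mem_insert_self _ _⟩
    have hlt : ∀ s ∈ insert ⊥ F, s < a := by
      intro s hs
      rcases Finset.mem_insert.1 hs with rfl | hs
      · exact bot_lt_iff_ne_bot.2 hab
      · exact ha s hs
    obtain ⟨w, hw1, hw2⟩ : ∃ w, dist (γ m) w ≤ v a - v m ∧ (v a < r → P w = η a) := by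
      by_cases hva : v a < r
      · have hma := hmono (hlt m hm).le
        have hd := h1 ⊥ (Finset.mem_insert_self _ _) m hm bot_le
        rw [h0, hv0] at hd
        obtain ⟨w, hw, hw'⟩ := hP.step hcompact (z := γ m) (y := η a) (d := v a - v m)
          (by rw [h2 m hm (by linarith)]; exact hv _ _ (hlt m hm).le) (by linarith)
        exact ⟨w, hw', fun _ => hw⟩
      · exact ⟨γ m, by simpa using hmono (hlt m hm).le, fun h => absurd h hva⟩
    have hmem : ∀ s ∈ insert ⊥ (insert a F), s = a ∨ s ∈ insert ⊥ F := by
      intro s hs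
      simp only [Finset.mem_insert] at hs ⊢
      tauto
    refine ⟨Function.update γ a w, ?_, ?_, ?_⟩
    · rw [Function.update_of_ne (Ne.symm hab), h0]
    · intro s hs t ht hst
      rcases hmem s hs with rfl | hs'
      · rcases hmem t ht with rfl | ht
        · simp
        · exact absurd hst (not_le.2 (hlt t ht))
      · rw [Function.update_of_ne (hlt s hs').ne]
        rcases hmem t ht with rfl | ht
        · rw [Function.update_self]
          have := h1 s hs' m hm (hmax s hs')
          linarith [dist_triangle (γ s) (γ m) w]
        · rw [Function.update_of_ne (hlt t ht).ne]
          exact h1 s hs' t ht hst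
    · intro s hs hsr
      rcases hmem s hs with rfl | hs
      · rw [Function.update_self]; exact hw2 hsr
      · rw [Function.update_of_ne (hlt s hs).ne]; exact h2 s hs hsr

theorem IsSubmetry.weak_lift {X Y I : Type*} [MetricSpace X] [MetricSpace Y]
    [LinearOrder I] [OrderBot I]
    {P : X → Y} (hP : IsSubmetry P) {x : X} {r : ℝ} (hr : 0 < r)
    (hcompact : IsCompact (Metric.closedBall x r))
    (η : I → Y) (hη0 : η ⊥ = P x) (v : I → ℝ) (hv0 : v ⊥ = 0) (hvr : ∀ t, v t ≤ r)
    (hv : ∀ s t, s ≤ t → dist (η s) (η t) ≤ v t - v s) :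
    ∃ γ : I → X, γ ⊥ = x ∧ (∀ s t, s ≤ t → dist (γ s) (γ t) ≤ v t - v s) ∧
      (∀ s, v s < r → P (γ s) = η s) := by
  classical
  have hK : IsCompact (Set.pi univ fun _ : I => Metric.closedBall x r) :=
    isCompact_univ_pi fun _ => hcompact
  refine Exists.elim (hK.inter_iInter_nonempty
    (fun p : I × I => {f : I → X | f ⊥ = x} ∩
      ({f : I → X | p.1 ≤ p.2 → dist (f p.1) (f p.2) ≤ v p.2 - v p.1} ∩
      {f : I → X | v p.1 < r → P (f p.1) = η p.1})) ?_ ?_) ?_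
  · rintro ⟨s, t⟩
    have hPc := hP.lip.continuous
    refine (isClosed_eq (by fun_prop) (by fun_prop)).inter (IsClosed.inter ?_ ?_)
    · by_cases h : s ≤ t
      · simp only [h, true_imp_iff]
        exact isClosed_le (by fun_prop) (by fun_prop)
      · simp [h]
    · by_cases h : v s < r
      · simp only [h, true_imp_iff]
        exact isClosed_eq (by fun_prop) (by fun_prop)
      · simp [h]
  · intro u
    obtain ⟨γ, h0, h1, h2⟩ := hP.finite_lift hcompact η hη0 v hv0 hv
      (u.image Prod.fst ∪ u.image Prod.snd)
    set F := insert ⊥ (u.image Prod.fst ∪ u.image Prod.snd) with hF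
    have hb : ⊥ ∈ F := Finset.mem_insert_self _ _
    refine ⟨fun s => if s ∈ F then γ s else x, ?_, ?_⟩
    · intro s _
      by_cases hs : s ∈ F
      · simp only [hs, if_true, Metric.mem_closedBall]
        have := h1 ⊥ hb s hs bot_le
        rw [h0, hv0, dist_comm] at this
        linarith [hvr s]
      · simp [hs, hr.le]
    · simp only [mem_iInter]
      rintro ⟨s, t⟩ hst
      have hs : s ∈ F := by
        refine Finset.mem_insert_of_mem (Finset.mem_union_left _ ?_)
        exact Finset.mem_image_of_mem Prod.fst hst
      have ht : t ∈ F := by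
        refine Finset.mem_insert_of_mem (Finset.mem_union_right _ ?_)
        exact Finset.mem_image_of_mem Prod.snd hst
      refine ⟨?_, ?_, ?_⟩
      · simp [hb, h0]
      · simpa [hs, ht] using h1 s hs t ht
      · simpa [hs] using h2 s hs
  · rintro γ ⟨-, hγ⟩
    rw [mem_iInter] at hγ
    exact ⟨γ, (hγ (⊥, ⊥)).1, fun s t => (hγ (s, t)).2.1, fun s => (hγ (s, s)).2.2⟩

/-- Horizontal lifting of rectifiable curves: if the closed ball of radius `r`
around `x` is compact and `η` is a curve in the base of length at most `r`
starting at `P x`, then `η` admits a horizontal lift starting at `x`. -/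
theorem submetry_horizontal_lift {X Y : Type*} [MetricSpace X] [MetricSpace Y]
    (P : X → Y) (hP : IsSubmetry P) (x : X) (r : ℝ) (hr : 0 < r)
    (hcompact : IsCompact (Metric.closedBall x r))
    (η : ℝ → Y) (hη : ContinuousOn η (Set.Icc 0 1)) (hη0 : η 0 = P x)
    (hlen : eVariationOn η (Set.Icc 0 1) ≤ ENNReal.ofReal r) :
    ∃ γ : ℝ → X, ContinuousOn γ (Set.Icc 0 1) ∧ γ 0 = x ∧
      (∀ t ∈ Set.Icc (0 : ℝ) 1, P (γ t) = η t) ∧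
      eVariationOn γ (Set.Icc 0 1) = eVariationOn η (Set.Icc 0 1) := by
  have hbv : BoundedVariationOn η (Icc 0 1) := (hlen.trans_lt ENNReal.ofReal_lt_top).ne
  have hloc := hbv.locallyBoundedVariationOn
  have m0 : (0:ℝ) ∈ Icc (0:ℝ) 1 := by simp
  have m1 : (1:ℝ) ∈ Icc (0:ℝ) 1 := by simp
  obtain ⟨v, hvdef⟩ : ∃ v, v = variationOnFromTo η (Icc 0 1) 0 := ⟨_, rfl⟩
  have hv0 : v 0 = 0 := by rw [hvdef]; exact variationOnFromTo.self _ _ _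
  have hsub : ∀ s ∈ Icc (0:ℝ) 1, ∀ t ∈ Icc (0:ℝ) 1, s ≤ t →
      v t - v s = (eVariationOn η (Icc 0 1 ∩ Icc s t)).toReal := by
    intro s hs t ht hst
    rw [hvdef, variationOnFromTo.sub_right hloc m0 ht hs, variationOnFromTo.eq_of_le _ _ hst]
  have hv : ∀ s ∈ Icc (0:ℝ) 1, ∀ t ∈ Icc (0:ℝ) 1, s ≤ t → dist (η s) (η t) ≤ v t - v s := by
    intro s hs t ht hst
    rw [hsub s hs t ht hst, dist_edist]
    exact ENNReal.toReal_mono (hloc s t hs ht)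
      (eVariationOn.edist_le η ⟨hs, le_rfl, hst⟩ ⟨ht, hst, le_rfl⟩)
  have hmono : MonotoneOn v (Icc 0 1) := by
    rw [hvdef]; exact variationOnFromTo.monotoneOn hloc m0
  have hv1 : ENNReal.ofReal (v 1) = eVariationOn η (Icc 0 1) := by
    have := hsub 0 m0 1 m1 zero_le_one
    rw [hv0, sub_zero, inter_self] at this
    rw [this, ENNReal.ofReal_toReal hbv]
  have hvr : ∀ t ∈ Icc (0:ℝ) 1, v t ≤ r := by
    intro t ht
    refine (hmono ht m1 ht.2).trans ?_
    rw [← hv1] at hlen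
    exact (ENNReal.ofReal_le_ofReal_iff hr.le).1 hlen
  have hvc : ContinuousOn v (Icc 0 1) := by
    intro t ht
    have hl := hbv.tendsto_eVariationOn_Icc_zero_left (x := t) ((hη t ht).mono inter_subset_left)
    have hrr := hbv.tendsto_eVariationOn_Icc_zero_right t ((hη t ht).mono inter_subset_left)
    have hl' := (ENNReal.tendsto_toReal ENNReal.zero_ne_top).comp hl
    have hr' := (ENNReal.tendsto_toReal ENNReal.zero_ne_top).comp hrr
    have hsum := hl'.add hr'
    simp only [ENNReal.toReal_zero, add_zero] at hsum
    refine tendsto_iff_dist_tendsto_zero.2 (squeeze_zero' (Eventually.of_forall fun _ => dist_nonneg) ?_ hsum)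
    filter_upwards [self_mem_nhdsWithin] with s hs
    simp only [Function.comp]
    have e1 : 0 ≤ (eVariationOn η (Icc 0 1 ∩ Icc s t)).toReal := ENNReal.toReal_nonneg
    have e2 : 0 ≤ (eVariationOn η (Icc 0 1 ∩ Icc t s)).toReal := ENNReal.toReal_nonneg
    rcases le_total s t with h | h
    · have := hsub s hs t ht h
      rw [Real.dist_eq, abs_sub_comm, abs_of_nonneg (by linarith)]; linarith
    · have := hsub t ht s hs h
      rw [Real.dist_eq, abs_of_nonneg (by linarith)]; linarith
  obtain ⟨g, g0, g1, g2⟩ := hP.weak_lift (I := Icc (0:ℝ) 1) hr hcompact (fun t => η t) hη0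
    (fun t => v t) hv0 (fun t => hvr t t.2) (fun s t h => hv s s.2 t t.2 h)
  obtain ⟨γ, hγdef⟩ : ∃ γ : ℝ → X, γ = fun t => g (projIcc 0 1 zero_le_one t) := ⟨_, rfl⟩
  have hγ : ∀ t (ht : t ∈ Icc (0:ℝ) 1), γ t = g ⟨t, ht⟩ := by
    intro t ht; rw [hγdef]; simp only; rw [projIcc_of_mem _ ht]
  have hγ1 : ∀ s ∈ Icc (0:ℝ) 1, ∀ t ∈ Icc (0:ℝ) 1, s ≤ t → dist (γ s) (γ t) ≤ v t - v s := by
    intro s hs t ht hst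
    rw [hγ s hs, hγ t ht]; exact g1 _ _ hst
  have hγd : ∀ s ∈ Icc (0:ℝ) 1, ∀ t ∈ Icc (0:ℝ) 1, dist (γ s) (γ t) ≤ dist (v s) (v t) := by
    intro s hs t ht
    rcases le_total s t with h | h
    · rw [dist_comm (v s)]
      exact (hγ1 s hs t ht h).trans (le_abs_self _)
    · rw [dist_comm (γ s)]
      exact (hγ1 t ht s hs h).trans (le_abs_self _)
  have hlift : ∀ t ∈ Set.Icc (0 : ℝ) 1, P (γ t) = η t := by
    intro t ht
    by_cases h : v t < r
    · rw [hγ t ht]; exact g2 _ h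
    have hvt : v t = r := le_antisymm (hvr t ht) (not_lt.1 h)
    refine eq_of_forall_dist_le fun ε hε => ?_
    have hsubset : Icc 0 t ⊆ Icc (0:ℝ) 1 := Icc_subset_Icc_right ht.2
    have hiv := intermediate_value_Icc ht.1 (hvc.mono hsubset)
    rw [hv0, hvt] at hiv
    obtain ⟨s, hs, hvs⟩ := hiv (show max 0 (r - ε / 2) ∈ Icc 0 r from
      ⟨le_max_left _ _, max_le hr.le (by linarith)⟩)
    have hs' := hsubset hs
    have hlt : v s < r := by rw [hvs]; exact max_lt hr (by linarith)
    have hge : r - ε / 2 ≤ v s := by rw [hvs]; exact le_max_right _ _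
    have e1 : P (γ s) = η s := by rw [hγ s hs']; exact g2 _ hlt
    have e2 := hP.dist_le' (γ s) (γ t)
    have e3 := hγ1 s hs' t ht hs.2
    have e4 := hv s hs' t ht hs.2
    have e5 := dist_triangle_left (P (γ t)) (η t) (η s)
    rw [e1] at e2
    linarith
  refine ⟨γ, ?_, ?_, hlift, le_antisymm ?_ ?_⟩
  · intro t ht
    refine tendsto_iff_dist_tendsto_zero.2 (squeeze_zero' (Eventually.of_forall fun _ => dist_nonneg) ?_
      (tendsto_iff_dist_tendsto_zero.1 (hvc t ht)))
    filter_upwards [self_mem_nhdsWithin] with s hs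
    exact hγd s hs t ht
  · rw [hγ 0 m0]; exact g0
  · have h1 : eVariationOn γ (Icc 0 1) ≤ eVariationOn v (Icc 0 1) := by
      refine iSup_le ?_
      rintro ⟨n, ⟨u, hu, us⟩⟩
      refine le_trans (Finset.sum_le_sum fun i _ => ?_) (eVariationOn.sum_le (f := v) (n := n) hu us)
      rw [edist_dist, edist_dist]
      exact ENNReal.ofReal_le_ofReal (hγd _ (us _) _ (us _))
    have h2 := hmono.eVariationOn_eq m0 m1
    rw [inter_self, hv0, sub_zero, hv1] at h2
    exact h1.trans h2.le
  · have h1 := (hP.lip.lipschitzOnWith (s := univ)).comp_eVariationOn_le (g := γ) (s := Icc 0 1)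
      (mapsTo_univ _ _)
    rw [eVariationOn.congr (f := P ∘ γ) (g := η) (fun t ht => hlift t ht)] at h1
    simpa using h1
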